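/- arXiv:2011.06389 — 4 statements merged into one kernel-verified Lean document; each statement's English description precedes it below -/
import Mathlib

section
/- Let ρ > 0 and 1 < α < 2 be real numbers, and let C > 0 be a constant such that ln(1+z) ≤ C·min(z, √z) for all z > 0. Then for every u > 3, ∫_0^∞ K_ρ(u,z) dμ_α(z) ≤ C^2·ρ(ρ+1)·u^{−α}·(ln u)^{−2} · ∫_0^∞ min(z, z^2) dμ_α(z). -/
open MeasureTheory

/-- `K_ρ(u,z) := (ln(u+z)/ln u)^{-ρ} + ρ·(ln(u+z)/ln u) − (ρ+1)`. -/
noncomputable def Kfun (ρ u z : ℝ) : ℝ :=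
  (Real.log (u + z) / Real.log u) ^ (-ρ) + ρ * (Real.log (u + z) / Real.log u) - (ρ + 1)

/-- The `α`-stable measure on `(0,∞)` with density
`z ↦ (α(α−1)/Γ(2−α))·z^{−1−α}` with respect to Lebesgue measure. -/
noncomputable def muAlpha (α : ℝ) : Measure ℝ :=
  (volume.withDensity
    (fun z => ENNReal.ofReal ((α * (α - 1) / Real.Gamma (2 - α)) * z ^ (-1 - α)))).restrict
    (Set.Ioi 0)

theorem exp_bern (p x : ℝ) (hx : 0 < x) (q : ℝ) (hq : q = 1 + p * Real.log x) : q ≤ x ^ p := by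
  rw [Real.rpow_def_of_pos hx, hq]
  have := Real.add_one_le_exp (Real.log x * p)
  linarith

theorem K_aux (ρ x : ℝ) (hρ : 0 < ρ) (hx : 1 ≤ x) :
    0 ≤ x ^ (-ρ) + ρ * x - (ρ + 1) ∧
      x ^ (-ρ) + ρ * x - (ρ + 1) ≤ ρ * (ρ + 1) * (x - 1) ^ 2 := by
  have hx0 : 0 < x := by linarith
  have hl := Real.log_le_sub_one_of_pos hx0
  have hl2 := Real.one_sub_inv_le_log_of_pos hx0
  have h1 := exp_bern (-ρ) x hx0 _ rfl
  have h2 := exp_bern (-ρ - 1) x hx0 _ rfl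
  have h3 := exp_bern ρ x hx0 _ rfl
  constructor
  · nlinarith
  · have h4 : x ^ (-ρ) * x ^ ρ = 1 := by
      rw [← Real.rpow_add hx0]; simp
    have h5 : x ^ (-ρ - 1) = x ^ (-ρ) * x⁻¹ := by
      rw [Real.rpow_sub hx0, Real.rpow_one]; rfl
    have hp : 0 < x ^ (-ρ) := Real.rpow_pos_of_pos hx0 _
    have h6 : x ^ (-ρ) * (1 + ρ * (1 - x⁻¹)) ≤ 1 := by
      rw [← h4]
      apply mul_le_mul_of_nonneg_left _ hp.le
      nlinarith
    have h7 : x ^ (-ρ) * (1 - x⁻¹) = x ^ (-ρ - 1) * (x - 1) := by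
      rw [h5]; field_simp
    have h8 : 1 - (ρ + 1) * (x - 1) ≤ x ^ (-ρ - 1) := by nlinarith
    have h9 : (1 - (ρ + 1) * (x - 1)) * (x - 1) ≤ x ^ (-ρ - 1) * (x - 1) :=
      mul_le_mul_of_nonneg_right h8 (by linarith)
    have h10 := mul_le_mul_of_nonneg_left h9 hρ.le
    rw [← h7] at h10
    nlinarith

theorem K_bound (ρ C u z : ℝ) (hρ : 0 < ρ) (hC : 0 < C)
    (hlog : ∀ z : ℝ, 0 < z → Real.log (1 + z) ≤ C * min z (Real.sqrt z)) (hu : 3 < u)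
    (hz : 0 < z) :
    0 ≤ Kfun ρ u z ∧
      Kfun ρ u z ≤ C ^ 2 * ρ * (ρ + 1) * Real.log u ^ (-2 : ℝ) * min (z / u) ((z / u) ^ 2) := by
  have hL : 0 < Real.log u := Real.log_pos (by linarith)
  have hu0 : 0 < u := by linarith
  have hw : 0 < z / u := by positivity
  have e1 : Real.log (u + z) = Real.log u + Real.log (1 + z / u) := by
    rw [← Real.log_mul (by positivity) (by positivity)]
    congr 1; field_simp
  have e2 : Real.log (u + z) / Real.log u - 1 = Real.log (1 + z / u) / Real.log u := by
    rw [e1]; field_simp; ring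
  have h0 : 0 ≤ Real.log (1 + z / u) := Real.log_nonneg (by linarith)
  have hx : 1 ≤ Real.log (u + z) / Real.log u := by
    have : 0 ≤ Real.log (1 + z / u) / Real.log u := by positivity
    linarith
  obtain ⟨ha, hb⟩ := K_aux ρ _ hρ hx
  refine ⟨ha, hb.trans ?_⟩
  rw [e2]
  have h1 := hlog _ hw
  have h2 : Real.log (1 + z / u) ^ 2 ≤ (C * min (z / u) (Real.sqrt (z / u))) ^ 2 :=
    pow_le_pow_left₀ h0 h1 2
  have h3 : (min (z / u) (Real.sqrt (z / u))) ^ 2 ≤ min (z / u) ((z / u) ^ 2) := by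
    have hm : 0 ≤ min (z / u) (Real.sqrt (z / u)) := by positivity
    apply le_min
    · calc _ ≤ (Real.sqrt (z / u)) ^ 2 := pow_le_pow_left₀ hm (min_le_right _ _) 2
        _ = _ := Real.sq_sqrt hw.le
    · exact pow_le_pow_left₀ hm (min_le_left _ _) 2
  have h4 : Real.log u ^ (-2 : ℝ) = (Real.log u ^ 2)⁻¹ := by
    rw [Real.rpow_neg hL.le]; norm_num
  rw [h4, div_pow, div_eq_mul_inv]
  calc ρ * (ρ + 1) * (Real.log (1 + z / u) ^ 2 * (Real.log u ^ 2)⁻¹)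
      ≤ ρ * (ρ + 1) * ((C ^ 2 * min (z / u) ((z / u) ^ 2)) * (Real.log u ^ 2)⁻¹) := by
        gcongr
        rw [mul_pow] at h2
        exact h2.trans (by gcongr)
    _ = _ := by ring

theorem mu_int (α : ℝ) (hα1 : 1 < α) (hα2 : α < 2) (f : ℝ → ℝ) :
    ∫ z in Set.Ioi (0 : ℝ), f z ∂(muAlpha α) =
      ∫ z in Set.Ioi (0 : ℝ), ((α * (α - 1) / Real.Gamma (2 - α)) * z ^ (-1 - α)) * f z := by
  have hG : 0 < Real.Gamma (2 - α) := Real.Gamma_pos_of_pos (by linarith)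
  have hc : 0 < α - 1 := by linarith
  unfold muAlpha
  rw [Measure.restrict_restrict measurableSet_Ioi, Set.inter_self,
    restrict_withDensity measurableSet_Ioi,
    integral_withDensity_eq_integral_toReal_smul (by fun_prop) (by simp)]
  apply setIntegral_congr_fun measurableSet_Ioi
  intro z hz
  have hz' : (0 : ℝ) < z := hz
  simp only [smul_eq_mul]
  rw [ENNReal.toReal_ofReal (by positivity)]

theorem g_int (α : ℝ) (hα1 : 1 < α) (hα2 : α < 2) :
    IntegrableOn (fun z : ℝ => z ^ (-1 - α) * min z (z ^ 2)) (Set.Ioi 0) := by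
  rw [← Set.Ioc_union_Ioi_eq_Ioi (zero_le_one (α := ℝ))]
  apply IntegrableOn.union
  · have h : IntegrableOn (fun z : ℝ => z ^ (1 - α)) (Set.Ioc 0 1) :=
      (intervalIntegrable_iff_integrableOn_Ioc_of_le zero_le_one).1
        (intervalIntegral.intervalIntegrable_rpow' (by linarith))
    refine h.congr_fun (fun z hz => ?_) measurableSet_Ioc
    have : z ^ 2 ≤ z := by nlinarith [hz.1, hz.2]
    simp only [min_eq_right this]
    rw [← Real.rpow_natCast, ← Real.rpow_add hz.1]
    congr 1; push_cast; ring
  · have h : IntegrableOn (fun z : ℝ => z ^ (-α)) (Set.Ioi 1) :=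
      integrableOn_Ioi_rpow_of_lt (by linarith) zero_lt_one
    refine h.congr_fun (fun z hz => ?_) measurableSet_Ioi
    have hz' : 1 < z := hz
    have : z ≤ z ^ 2 := by nlinarith
    simp only [min_eq_left this]
    nth_rw 3 [← Real.rpow_one z]
    rw [← Real.rpow_add (by linarith)]
    congr 1; ring

theorem g_scale (α u : ℝ) (hu : 0 < u) :
    ∀ z ∈ Set.Ioi (0 : ℝ), z ^ (-1 - α) * min (z / u) ((z / u) ^ 2) =
      u ^ (-1 - α) * ((fun y : ℝ => y ^ (-1 - α) * min y (y ^ 2)) (u⁻¹ * z)) := by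
  intro z hz
  have hz' : (0 : ℝ) < z := hz
  have e : u⁻¹ * z = z / u := by field_simp
  have h : z ^ (-1 - α) = u ^ (-1 - α) * (z / u) ^ (-1 - α) := by
    rw [← Real.mul_rpow hu.le (by positivity)]; congr 1; field_simp
  simp only [e]
  rw [h]; ring

theorem stmt_5 (ρ α C : ℝ) (hρ : 0 < ρ) (hα1 : 1 < α) (hα2 : α < 2) (hC : 0 < C)
    (hlog : ∀ z : ℝ, 0 < z → Real.log (1 + z) ≤ C * min z (Real.sqrt z)) :
    ∀ u : ℝ, 3 < u →
      (∫ z in Set.Ioi (0 : ℝ), Kfun ρ u z ∂(muAlpha α)) ≤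
        C ^ 2 * ρ * (ρ + 1) * u ^ (-α) * Real.log u ^ (-2 : ℝ) *
          ∫ z in Set.Ioi (0 : ℝ), min z (z ^ 2) ∂(muAlpha α) := by
  intro u hu
  have hu0 : 0 < u := by linarith
  have hG : 0 < Real.Gamma (2 - α) := Real.Gamma_pos_of_pos (by linarith)
  have hα : 0 < α - 1 := by linarith
  rw [mu_int α hα1 hα2, mu_int α hα1 hα2]
  set c := α * (α - 1) / Real.Gamma (2 - α) with hc
  have hc0 : 0 < c := by positivity
  set A := C ^ 2 * ρ * (ρ + 1) * Real.log u ^ (-2 : ℝ) with hA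
  set g : ℝ → ℝ := fun y : ℝ => y ^ (-1 - α) * min y (y ^ 2) with hg
  have gi : IntegrableOn g (Set.Ioi 0) := g_int α hα1 hα2
  have gi' : IntegrableOn (fun z => g (u⁻¹ * z)) (Set.Ioi 0) := by
    rw [integrableOn_Ioi_comp_mul_left_iff g 0 (inv_pos.2 hu0)]
    simpa using gi
  have key : ∫ z in Set.Ioi (0 : ℝ), (c * z ^ (-1 - α)) * Kfun ρ u z ≤
      ∫ z in Set.Ioi (0 : ℝ), (c * A * u ^ (-1 - α)) * g (u⁻¹ * z) := by
    apply integral_mono_of_nonneg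
    · filter_upwards [ae_restrict_mem measurableSet_Ioi] with z hz
      have hz' : (0 : ℝ) < z := hz
      have := (K_bound ρ C u z hρ hC hlog hu hz').1
      simp only [Pi.zero_apply]
      positivity
    · exact gi'.const_mul _
    · filter_upwards [ae_restrict_mem measurableSet_Ioi] with z hz
      have hz' : (0 : ℝ) < z := hz
      have h1 := (K_bound ρ C u z hρ hC hlog hu hz').2
      have h2 := g_scale α u hu0 z hz
      have h3 : 0 ≤ c * z ^ (-1 - α) := by positivity
      calc c * z ^ (-1 - α) * Kfun ρ u z
          ≤ c * z ^ (-1 - α) * (A * min (z / u) ((z / u) ^ 2)) :=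
            mul_le_mul_of_nonneg_left h1 h3
        _ = c * A * (z ^ (-1 - α) * min (z / u) ((z / u) ^ 2)) := by ring
        _ = c * A * u ^ (-1 - α) * g (u⁻¹ * z) := by rw [h2]; ring
  refine key.trans (le_of_eq ?_)
  rw [integral_const_mul, integral_comp_mul_left_Ioi g 0 (inv_pos.2 hu0)]
  have e : ∀ z : ℝ, c * z ^ (-1 - α) * min z (z ^ 2) = c * g z := fun z => by
    simp only [hg]; ring
  simp only [e, mul_zero, inv_inv, smul_eq_mul]
  rw [integral_const_mul]
  have h5 : u ^ (-α) = u ^ (-1 - α) * u := by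
    nth_rw 3 [← Real.rpow_one u]
    rw [← Real.rpow_add hu0]; congr 1; ring
  rw [h5, hA]; ring
end

section
/- Let 1 < α < 2 and let b_0, b_1, b_2, r_0, r_1, r_2 be real numbers. Then for every u > 0, −b_0·u^{r_0}·u^{−1} + (1/2)·b_1·u^{r_1}·u^{−2} + b_2·u^{r_2} · ∫_0^∞ z^2 · (∫_0^1 (u+v·z)^{−2}·(1−v) dv) dμ_α(z) = −b_0·u^{r_0−1} + (1/2)·b_1·u^{r_1−2} + Γ(α)·b_2·u^{r_2−α}. -/
open MeasureTheory

open MeasureTheory Set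

lemma aux_gamma (a r : ℝ) (ha : 0 < a) (hr : 0 < r) :
    ∫⁻ t in Ioi (0:ℝ), ENNReal.ofReal (t ^ (a - 1) * Real.exp (-(r * t)))
      = ENNReal.ofReal ((1 / r) ^ a * Real.Gamma a) := by
  have h := Real.integral_rpow_mul_exp_neg_mul_Ioi ha hr
  have hpos : 0 < (1 / r) ^ a * Real.Gamma a :=
    mul_pos (Real.rpow_pos_of_pos (by positivity) _) (Real.Gamma_pos_of_pos ha)
  rw [← h]
  symm
  apply ofReal_integral_eq_lintegral_ofReal
  · apply Integrable.of_integral_ne_zero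
    rw [h]; exact hpos.ne'
  · filter_upwards [ae_restrict_mem measurableSet_Ioi] with t ht
    exact mul_nonneg (Real.rpow_nonneg (le_of_lt ht) _) (Real.exp_pos _).le

lemma aux_beta (α : ℝ) (hα1 : 1 < α) :
    ∫⁻ v in Ioc (0:ℝ) 1, ENNReal.ofReal (v ^ (α - 2) * (1 - v))
      = ENNReal.ofReal (1 / (α * (α - 1))) := by
  have hi1 : IntervalIntegrable (fun v : ℝ => v ^ (α - 2)) volume 0 1 :=
    intervalIntegral.intervalIntegrable_rpow' (by linarith)
  have hi2 : IntervalIntegrable (fun v : ℝ => v ^ (α - 1)) volume 0 1 :=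
    intervalIntegral.intervalIntegrable_rpow' (by linarith)
  have hE : EqOn (fun v : ℝ => v ^ (α - 2) - v ^ (α - 1))
      (fun v : ℝ => v ^ (α - 2) * (1 - v)) (Ioc 0 1) := by
    intro v hv
    have : v ^ (α - 1) = v ^ (α - 2) * v := by
      rw [← Real.rpow_add_one hv.1.ne']; congr 1; ring
    simp only [this]; ring
  have hint : IntegrableOn (fun v : ℝ => v ^ (α - 2) * (1 - v)) (Ioc 0 1) := by
    have := (intervalIntegrable_iff_integrableOn_Ioc_of_le zero_le_one).1 (hi1.sub hi2)
    exact this.congr_fun hE measurableSet_Ioc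
  have hval : ∫ v in Ioc (0:ℝ) 1, v ^ (α - 2) * (1 - v) = 1 / (α * (α - 1)) := by
    rw [← setIntegral_congr_fun measurableSet_Ioc hE,
      ← intervalIntegral.integral_of_le zero_le_one, intervalIntegral.integral_sub hi1 hi2,
      integral_rpow (Or.inl (by linarith)), integral_rpow (Or.inl (by linarith))]
    have h1 : α - 2 + 1 = α - 1 := by ring
    have h2 : α - 1 + 1 = α := by ring
    rw [h1, h2, Real.zero_rpow (by linarith), Real.zero_rpow (by linarith)]
    have : α - 1 ≠ 0 := by linarith
    have : α ≠ 0 := by linarith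
    simp only [Real.one_rpow]
    field_simp
    ring
  rw [← hval]
  symm
  apply ofReal_integral_eq_lintegral_ofReal hint
  filter_upwards [ae_restrict_mem measurableSet_Ioc] with v hv
  exact mul_nonneg (Real.rpow_nonneg hv.1.le _) (by linarith [hv.2])

/-- integrand of the triple integral -/
noncomputable def GG (α u z v s : ℝ) : ℝ :=
  z ^ (1 - α) * (1 - v) * s * Real.exp (-(s * u)) * Real.exp (-(s * v * z))

lemma aux_s (α u z v : ℝ) (hu : 0 < u) (hz : 0 < z) (hv : v ∈ Ioc (0:ℝ) 1) :
    ∫⁻ s in Ioi (0:ℝ), ENNReal.ofReal (GG α u z v s)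
      = ENNReal.ofReal (z ^ (1 - α) * ((u + v * z) ^ (-2 : ℝ) * (1 - v))) := by
  have hr : 0 < u + v * z := by have := mul_pos hv.1 hz; linarith
  have h := aux_gamma 2 (u + v * z) two_pos hr
  have hc : 0 ≤ z ^ (1 - α) * (1 - v) :=
    mul_nonneg (Real.rpow_nonneg hz.le _) (by linarith [hv.2])
  have : ∀ s : ℝ, ENNReal.ofReal (GG α u z v s) = ENNReal.ofReal (z ^ (1 - α) * (1 - v)) *
      ENNReal.ofReal (s ^ ((2:ℝ) - 1) * Real.exp (-((u + v * z) * s))) := by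
    intro s
    rw [← ENNReal.ofReal_mul hc]
    congr 1
    have h1 : (2:ℝ) - 1 = 1 := by norm_num
    have h2 : -((u + v * z) * s) = -(s * u) + -(s * v * z) := by ring
    rw [h1, Real.rpow_one, h2, Real.exp_add, GG]; ring
  simp_rw [this]
  rw [lintegral_const_mul _ (by fun_prop), h, ← ENNReal.ofReal_mul hc, Real.Gamma_two,
    one_div, Real.inv_rpow hr.le, ← Real.rpow_neg hr.le]
  congr 1; ring

lemma aux_z (α u v s : ℝ) (hα2 : α < 2) (hs : 0 < s) (hv : v ∈ Ioc (0:ℝ) 1) :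
    ∫⁻ z in Ioi (0:ℝ), ENNReal.ofReal (GG α u z v s)
      = ENNReal.ofReal (Real.Gamma (2 - α) * (v ^ (α - 2) * (1 - v))) *
        ENNReal.ofReal (s ^ (α - 1) * Real.exp (-(u * s))) := by
  have hr : 0 < s * v := mul_pos hs hv.1
  have h := aux_gamma (2 - α) (s * v) (by linarith) hr
  have hc : 0 ≤ (1 - v) * s * Real.exp (-(s * u)) :=
    mul_nonneg (mul_nonneg (by linarith [hv.2]) hs.le) (Real.exp_pos _).le
  have : ∀ z : ℝ, ENNReal.ofReal (GG α u z v s) =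
      ENNReal.ofReal ((1 - v) * s * Real.exp (-(s * u))) *
      ENNReal.ofReal (z ^ (2 - α - 1) * Real.exp (-(s * v * z))) := by
    intro z
    rw [← ENNReal.ofReal_mul hc]
    congr 1
    have h1 : 2 - α - 1 = 1 - α := by ring
    rw [h1, GG]; ring
  simp_rw [this]
  have hG := Real.Gamma_pos_of_pos (show 0 < 2 - α by linarith)
  rw [lintegral_const_mul _ (by fun_prop), h, ← ENNReal.ofReal_mul hc,
    ← ENNReal.ofReal_mul (mul_nonneg hG.le (mul_nonneg (Real.rpow_nonneg hv.1.le _)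
      (by linarith [hv.2]))), one_div, Real.inv_rpow hr.le, ← Real.rpow_neg hr.le,
    Real.mul_rpow hs.le hv.1.le]
  have h1 : -(2 - α) = α - 2 := by ring
  have h2 : s ^ (α - 1) = s ^ (α - 2) * s := by
    rw [← Real.rpow_add_one hs.ne']; congr 1; ring
  rw [h1, h2, mul_comm u s]
  congr 1; ring

lemma aux_triple (α u : ℝ) (hα1 : 1 < α) (hα2 : α < 2) (hu : 0 < u) :
    ∫⁻ z in Ioi (0:ℝ), ∫⁻ v in Ioc (0:ℝ) 1, ∫⁻ s in Ioi (0:ℝ), ENNReal.ofReal (GG α u z v s)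
      = ENNReal.ofReal (Real.Gamma (2 - α) * (1 / (α * (α - 1))) *
          (u ^ (-α) * Real.Gamma α)) := by
  have hm : Measurable (fun p : (ℝ × ℝ) × ℝ => ENNReal.ofReal (GG α u p.1.1 p.1.2 p.2)) := by
    unfold GG; fun_prop
  have hG := Real.Gamma_pos_of_pos (show 0 < 2 - α by linarith)
  rw [lintegral_lintegral_swap]
  swap
  · exact (hm.lintegral_prod_right' (ν := volume.restrict (Ioi 0))).aemeasurable
  have h1 : ∀ v ∈ Ioc (0:ℝ) 1,
      ∫⁻ z in Ioi (0:ℝ), ∫⁻ s in Ioi (0:ℝ), ENNReal.ofReal (GG α u z v s) =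
      ENNReal.ofReal (v ^ (α - 2) * (1 - v)) *
        ENNReal.ofReal (Real.Gamma (2 - α) * (u ^ (-α) * Real.Gamma α)) := by
    intro v hv
    rw [lintegral_lintegral_swap]
    swap
    · exact (hm.comp (g := fun p : (ℝ × ℝ) × ℝ => ENNReal.ofReal (GG α u p.1.1 p.1.2 p.2))
        (f := fun q : ℝ × ℝ => ((q.1, v), q.2)) (by fun_prop)).aemeasurable
    rw [setLIntegral_congr_fun measurableSet_Ioi
      (fun s hs => aux_z α u v s hα2 hs hv), lintegral_const_mul _ (by fun_prop),
      aux_gamma α u (by linarith) hu, one_div, Real.inv_rpow hu.le, ← Real.rpow_neg hu.le]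
    have hb : 0 ≤ v ^ (α - 2) * (1 - v) :=
      mul_nonneg (Real.rpow_nonneg hv.1.le _) (by linarith [hv.2])
    rw [← ENNReal.ofReal_mul hb, ← ENNReal.ofReal_mul (mul_nonneg hG.le hb)]
    congr 1; ring
  rw [setLIntegral_congr_fun measurableSet_Ioc h1, lintegral_mul_const _ (by fun_prop),
    aux_beta α hα1, ← ENNReal.ofReal_mul]
  · congr 1; ring
  · have : 0 < α - 1 := by linarith
    have : 0 < α := by linarith
    positivity

lemma aux_main (α u : ℝ) (hα1 : 1 < α) (hα2 : α < 2) (hu : 0 < u) :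
    ∫ z in Set.Ioi (0 : ℝ),
      z ^ 2 * (∫ v in (0 : ℝ)..1, (u + v * z) ^ (-2 : ℝ) * (1 - v)) ∂(muAlpha α)
      = Real.Gamma α * u ^ (-α) := by
  have hG := Real.Gamma_pos_of_pos (show 0 < 2 - α by linarith)
  have hGa := Real.Gamma_pos_of_pos (show 0 < α by linarith)
  have ha1 : 0 < α - 1 := by linarith
  have ha : 0 < α := by linarith
  have hC : 0 < α * (α - 1) / Real.Gamma (2 - α) := by positivity
  have hu' := Real.rpow_pos_of_pos hu (-α)
  simp_rw [intervalIntegral.integral_of_le (zero_le_one (α := ℝ))]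
  have hmf : Measurable (fun z : ℝ =>
      z ^ 2 * ∫ v in Ioc (0:ℝ) 1, (u + v * z) ^ (-2 : ℝ) * (1 - v)) := by
    refine Measurable.mul (by fun_prop) ?_
    have : Measurable (fun p : ℝ × ℝ => (u + p.2 * p.1) ^ (-2 : ℝ) * (1 - p.2)) := by fun_prop
    exact (this.stronglyMeasurable.integral_prod_right'
      (ν := volume.restrict (Ioc (0:ℝ) 1))).measurable
  rw [muAlpha, Measure.restrict_restrict measurableSet_Ioi, inter_self,
    integral_eq_lintegral_of_nonneg_ae _ hmf.aestronglyMeasurable,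
    restrict_withDensity measurableSet_Ioi,
    lintegral_withDensity_eq_lintegral_mul _ (by fun_prop) hmf.ennreal_ofReal]
  · have key : ∀ z ∈ Ioi (0:ℝ),
        ((fun z => ENNReal.ofReal ((α * (α - 1) / Real.Gamma (2 - α)) * z ^ (-1 - α))) *
          fun z : ℝ => ENNReal.ofReal
            (z ^ 2 * ∫ v in Ioc (0:ℝ) 1, (u + v * z) ^ (-2 : ℝ) * (1 - v))) z
        = ENNReal.ofReal (α * (α - 1) / Real.Gamma (2 - α)) *
          ∫⁻ v in Ioc (0:ℝ) 1, ∫⁻ s in Ioi (0:ℝ), ENNReal.ofReal (GG α u z v s) := by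
      intro z hz
      have hz : 0 < z := hz
      rw [setLIntegral_congr_fun measurableSet_Ioc (fun v hv => aux_s α u z v hu hz hv),
        ← ofReal_integral_eq_lintegral_ofReal, integral_const_mul, Pi.mul_apply,
        ← ENNReal.ofReal_mul (by positivity), ← ENNReal.ofReal_mul hC.le]
      · have : z ^ (1 - α) = z ^ (-1 - α) * z ^ 2 := by
          rw [← Real.rpow_natCast, ← Real.rpow_add hz]; congr 1; push_cast; ring
        rw [this]; congr 1; ring
      · apply Integrable.const_mul
        refine IntegrableOn.mono_set (t := Icc 0 1) ?_ Ioc_subset_Icc_self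
        apply ContinuousOn.integrableOn_Icc
        apply ContinuousOn.mul _ (by fun_prop)
        apply ContinuousOn.rpow_const (by fun_prop)
        intro v hv
        left
        have := mul_nonneg hv.1 hz.le
        linarith
      · filter_upwards [ae_restrict_mem measurableSet_Ioc] with v hv
        have := mul_pos hv.1 hz
        exact mul_nonneg (Real.rpow_nonneg hz.le _) (mul_nonneg
          (Real.rpow_nonneg (by linarith) _) (by linarith [hv.2]))
    rw [setLIntegral_congr_fun measurableSet_Ioi key, lintegral_const_mul',
      aux_triple α u hα1 hα2 hu, ← ENNReal.ofReal_mul hC.le, ENNReal.toReal_ofReal]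
    · field_simp
    · positivity
    · exact ENNReal.ofReal_ne_top
  · filter_upwards [ae_restrict_mem measurableSet_Ioi] with z hz
    have hz : 0 < z := hz
    refine mul_nonneg (by positivity) (setIntegral_nonneg measurableSet_Ioc ?_)
    intro v hv
    have := mul_pos hv.1 hz
    exact mul_nonneg (Real.rpow_nonneg (by linarith) _) (by linarith [hv.2])

theorem stmt_8 (α b₀ b₁ b₂ r₀ r₁ r₂ : ℝ) (hα1 : 1 < α) (hα2 : α < 2) :
    ∀ u : ℝ, 0 < u →
      -b₀ * u ^ r₀ * u ^ (-1 : ℝ) + (1 / 2) * b₁ * u ^ r₁ * u ^ (-2 : ℝ)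
          + b₂ * u ^ r₂ *
            ∫ z in Set.Ioi (0 : ℝ),
              z ^ 2 * (∫ v in (0 : ℝ)..1, (u + v * z) ^ (-2 : ℝ) * (1 - v)) ∂(muAlpha α) =
        -b₀ * u ^ (r₀ - 1) + (1 / 2) * b₁ * u ^ (r₁ - 2) + Real.Gamma α * b₂ * u ^ (r₂ - α) := by
  intro u hu
  rw [aux_main α u hα1 hα2 hu]
  rw [sub_eq_add_neg r₀, sub_eq_add_neg r₁, sub_eq_add_neg r₂, Real.rpow_add hu,
    Real.rpow_add hu, Real.rpow_add hu]
  ring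
end

section
/- Let ρ > 0, 1 < α < 2, b_1 ≥ 0, b_2 ≥ 0 and r_1, r_2 real, and assume that either (b_1 > 0 and r_1 > 2) or (b_2 > 0 and r_2 > α). Define H_ρ(u) := (1/2)·b_1·u^{r_1−2} + b_2·u^{r_2} · ∫_0^∞ K_ρ(u,z) dμ_α(z) for u > 3. Then (ln u)^{−ρ−2} · H_ρ(u) → ∞ as u → ∞. -/
open MeasureTheory

lemma bern_neg (s p : ℝ) (hs : 0 ≤ s) (hp : p ≤ 0) : 1 + p * s ≤ (1 + s) ^ p := by
  have hx : (0:ℝ) < 1 + s := by linarith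
  have h1 : Real.log (1 + s) ≤ s := by
    have := Real.log_le_sub_one_of_pos hx
    linarith
  rw [Real.rpow_def_of_pos hx]
  have h2 := Real.add_one_le_exp (Real.log (1 + s) * p)
  nlinarith

lemma phi_upper (ρ t : ℝ) (hρ : 0 < ρ) (ht : 0 ≤ t) :
    (1 + t) ^ (-ρ) + ρ * (1 + t) - (ρ + 1) ≤ ρ * (ρ + 1) * t ^ 2 := by
  have hx : (0:ℝ) < 1 + t := by linarith
  have h1 : 1 + (ρ + 1) * t ≤ (1 + t) ^ (ρ + 1) :=
    one_add_mul_self_le_rpow_one_add (by linarith) (by linarith)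
  have h2 : (1 + t) ^ (-ρ) * (1 + t) ^ (ρ + 1) = 1 + t := by
    rw [← Real.rpow_add hx]; simp
  have h3 : 0 < (1 + t) ^ (-ρ) := Real.rpow_pos_of_pos hx _
  have h4 : (1 + t) ^ (-ρ) * (1 + (ρ + 1) * t) ≤ 1 + t := by
    exact (mul_le_mul_of_nonneg_left h1 h3.le).trans h2.le
  have h5 : 0 < 1 + (ρ + 1) * t := by positivity
  have h6 : (1 + t) ^ (-ρ) ≤ 1 - ρ * t + ρ * (ρ + 1) * t ^ 2 := by
    refine le_of_mul_le_mul_right (h4.trans ?_) h5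
    have : 0 ≤ ρ * (ρ + 1) * t ^ 2 * ((ρ + 1) * t) := by positivity
    nlinarith
  linarith

lemma phi_upper' (ρ t : ℝ) (hρ : 0 < ρ) (ht : 0 ≤ t) :
    (1 + t) ^ (-ρ) + ρ * (1 + t) - (ρ + 1) ≤ ρ * t := by
  have := Real.rpow_le_one_of_one_le_of_nonpos (x := 1 + t) (z := -ρ) (by linarith) (by linarith)
  linarith

lemma phi_nonneg (ρ t : ℝ) (hρ : 0 < ρ) (ht : 0 ≤ t) :
    0 ≤ (1 + t) ^ (-ρ) + ρ * (1 + t) - (ρ + 1) := by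
  have h := bern_neg t (-ρ) (by linarith) (by linarith)
  linarith

lemma phi_lower (ρ t : ℝ) (hρ : 0 < ρ) (ht : 0 ≤ t) (h : ρ * t ≤ 2) :
    ρ ^ 2 / 4 * t ^ 2 ≤ (1 + t) ^ (-ρ) + ρ * (1 + t) - (ρ + 1) := by
  have hx : (0:ℝ) < 1 + t := by linarith
  have h1 := bern_neg t (-ρ / 2) (by linarith) (by linarith)
  have h2 : (1 + t) ^ (-ρ) = (1 + t) ^ (-ρ / 2) * (1 + t) ^ (-ρ / 2) := by
    rw [← Real.rpow_add hx]; congr 1; ring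
  have h3 : (1 + -ρ / 2 * t) * (1 + -ρ / 2 * t) ≤ (1 + t) ^ (-ρ / 2) * (1 + t) ^ (-ρ / 2) :=
    mul_self_le_mul_self (by linarith) h1
  rw [h2]
  nlinarith

lemma ratio_eq (u z : ℝ) (hu : 3 < u) (hz : 0 < z) :
    Real.log (u + z) / Real.log u = 1 + Real.log (1 + z / u) / Real.log u := by
  have hl : 0 < Real.log u := Real.log_pos (by linarith)
  have : u + z = u * (1 + z / u) := by field_simp
  rw [this, Real.log_mul (by positivity) (by positivity)]
  field_simp

lemma t_bounds (u z : ℝ) (hu : 3 < u) (hz : 0 < z) :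
    0 ≤ Real.log (1 + z / u) / Real.log u ∧
      Real.log (1 + z / u) / Real.log u ≤ z / (u * Real.log u) := by
  have hl : 0 < Real.log u := Real.log_pos (by linarith)
  have h0 : 0 < z / u := by positivity
  constructor
  · exact div_nonneg (Real.log_nonneg (by linarith)) hl.le
  · rw [← div_div]
    gcongr
    have := Real.log_le_sub_one_of_pos (x := 1 + z / u) (by positivity)
    linarith

lemma K_nonneg (ρ u z : ℝ) (hρ : 0 < ρ) (hu : 3 < u) (hz : 0 < z) : 0 ≤ Kfun ρ u z := by
  unfold Kfun
  rw [ratio_eq u z hu hz]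
  exact phi_nonneg _ _ hρ (t_bounds u z hu hz).1

lemma K_le_lin (ρ u z : ℝ) (hρ : 0 < ρ) (hu : 3 < u) (hz : 0 < z) :
    Kfun ρ u z ≤ ρ * (1 / (u * Real.log u)) * z := by
  unfold Kfun
  rw [ratio_eq u z hu hz]
  obtain ⟨h1, h2⟩ := t_bounds u z hu hz
  refine (phi_upper' _ _ hρ h1).trans ?_
  rw [mul_assoc, one_div_mul_eq_div]
  gcongr

lemma K_le_sq (ρ u z : ℝ) (hρ : 0 < ρ) (hu : 3 < u) (hz : 0 < z) :
    Kfun ρ u z ≤ ρ * (ρ + 1) * (1 / (u * Real.log u)) ^ 2 * z ^ 2 := by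
  unfold Kfun
  rw [ratio_eq u z hu hz]
  obtain ⟨h1, h2⟩ := t_bounds u z hu hz
  refine (phi_upper _ _ hρ h1).trans ?_
  rw [mul_assoc _ _ (z ^ 2), ← mul_pow, one_div_mul_eq_div]
  gcongr

lemma K_lower (ρ u z : ℝ) (hρ : 0 < ρ) (hu : 3 < u) (hz : u < z) (hz2 : z ≤ 2 * u)
    (hul : ρ * Real.log 3 / 2 ≤ Real.log u) :
    ρ ^ 2 / 4 * (Real.log 2 / Real.log u) ^ 2 ≤ Kfun ρ u z := by
  have hz0 : 0 < z := by linarith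
  have hl : 0 < Real.log u := Real.log_pos (by linarith)
  have h2 : 0 < Real.log 2 := Real.log_pos (by norm_num)
  unfold Kfun
  rw [ratio_eq u z hu hz0]
  have hu0 : 0 < u := by linarith
  have a1 : 1 ≤ z / u := by rw [le_div_iff₀ hu0]; linarith
  have a2 : z / u ≤ 2 := by rw [div_le_iff₀ hu0]; linarith
  refine le_trans ?_ (phi_lower _ _ hρ (t_bounds u z hu hz0).1 ?_)
  · have : Real.log 2 ≤ Real.log (1 + z / u) := Real.log_le_log (by norm_num) (by linarith)
    gcongr
  · have : Real.log (1 + z / u) ≤ Real.log 3 := Real.log_le_log (by linarith) (by linarith)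
    rw [← mul_div_assoc, div_le_iff₀ hl]
    nlinarith

lemma int_eq (α : ℝ) (hα1 : 1 < α) (hα2 : α < 2) (f : ℝ → ℝ) :
    ∫ z in Set.Ioi (0 : ℝ), f z ∂(muAlpha α) =
      ∫ z in Set.Ioi (0 : ℝ), (α * (α - 1) / Real.Gamma (2 - α)) * z ^ (-1 - α) * f z := by
  have hG : 0 < Real.Gamma (2 - α) := Real.Gamma_pos_of_pos (by linarith)
  unfold muAlpha
  rw [Measure.restrict_restrict measurableSet_Ioi, Set.inter_self,
    setIntegral_withDensity_eq_setIntegral_toReal_smul (by fun_prop) (by simp) _ measurableSet_Ioi]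
  refine setIntegral_congr_fun measurableSet_Ioi fun z hz => ?_
  have hz : 0 < z := hz
  have : 0 < α - 1 := by linarith
  simp only [smul_eq_mul]
  rw [ENNReal.toReal_ofReal (by positivity)]

lemma K_integrable (ρ α u : ℝ) (hρ : 0 < ρ) (hα1 : 1 < α) (hα2 : α < 2) (hu : 3 < u) :
    IntegrableOn (fun z => (α * (α - 1) / Real.Gamma (2 - α)) * z ^ (-1 - α) * Kfun ρ u z)
      (Set.Ioi 0) := by
  have hG : 0 < Real.Gamma (2 - α) := Real.Gamma_pos_of_pos (by linarith)
  have hα0 : 0 < α - 1 := by linarith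
  set c := α * (α - 1) / Real.Gamma (2 - α) with hc
  have hc0 : 0 < c := by positivity
  have hm : Measurable (fun z => c * z ^ (-1 - α) * Kfun ρ u z) := by
    unfold Kfun; fun_prop
  rw [← Set.Ioc_union_Ioi_eq_Ioi zero_le_one]
  refine IntegrableOn.union ?_ ?_
  · have h1 : IntegrableOn (fun z : ℝ => z ^ (1 - α)) (Set.Ioc 0 1) := by
      rw [← intervalIntegrable_iff_integrableOn_Ioc_of_le zero_le_one]
      exact intervalIntegral.intervalIntegrable_rpow' (by linarith)
    refine (h1.const_mul (c * (ρ * (ρ + 1) * (1 / (u * Real.log u)) ^ 2))).mono'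
      hm.aestronglyMeasurable ?_
    refine (ae_restrict_iff' measurableSet_Ioc).2 (.of_forall fun z hz => ?_)
    have hz0 : 0 < z := hz.1
    have hK := K_nonneg ρ u z hρ hu hz0
    rw [Real.norm_of_nonneg (by positivity)]
    have e : z ^ (1 - α) = z ^ (-1 - α) * z ^ 2 := by
      rw [← Real.rpow_natCast z 2, ← Real.rpow_add hz0]; congr 1; push_cast; ring
    calc c * z ^ (-1 - α) * Kfun ρ u z
        ≤ c * z ^ (-1 - α) * (ρ * (ρ + 1) * (1 / (u * Real.log u)) ^ 2 * z ^ 2) := by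
          gcongr; exact K_le_sq ρ u z hρ hu hz0
      _ = _ := by rw [e]; ring
  · have h1 : IntegrableOn (fun z : ℝ => z ^ (-α)) (Set.Ioi 1) :=
      integrableOn_Ioi_rpow_of_lt (by linarith) zero_lt_one
    refine (h1.const_mul (c * (ρ * (1 / (u * Real.log u))))).mono'
      hm.aestronglyMeasurable ?_
    refine (ae_restrict_iff' measurableSet_Ioi).2 (.of_forall fun z hz => ?_)
    have hz0 : 0 < z := zero_lt_one.trans hz
    have hK := K_nonneg ρ u z hρ hu hz0
    rw [Real.norm_of_nonneg (by positivity)]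
    have e : z ^ (-α) = z ^ (-1 - α) * z := by
      nth_rw 3 [← Real.rpow_one z]
      rw [← Real.rpow_add hz0]; congr 1; ring
    calc c * z ^ (-1 - α) * Kfun ρ u z
        ≤ c * z ^ (-1 - α) * (ρ * (1 / (u * Real.log u)) * z) := by
          gcongr; exact K_le_lin ρ u z hρ hu hz0
      _ = _ := by rw [e]; ring

lemma int_nonneg (ρ α u : ℝ) (hρ : 0 < ρ) (hα1 : 1 < α) (hα2 : α < 2) (hu : 3 < u) :
    0 ≤ ∫ z in Set.Ioi (0 : ℝ), Kfun ρ u z ∂(muAlpha α) :=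
  setIntegral_nonneg measurableSet_Ioi fun z hz => K_nonneg ρ u z hρ hu hz

lemma int_lower (ρ α : ℝ) (hρ : 0 < ρ) (hα1 : 1 < α) (hα2 : α < 2) :
    ∃ D > 0, ∀ u : ℝ, 3 < u → ρ * Real.log 3 / 2 ≤ Real.log u →
      D * (u ^ (-α) * Real.log u ^ (-2 : ℝ)) ≤
        ∫ z in Set.Ioi (0 : ℝ), Kfun ρ u z ∂(muAlpha α) := by
  have hG : 0 < Real.Gamma (2 - α) := Real.Gamma_pos_of_pos (by linarith)
  have hα0 : 0 < α - 1 := by linarith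
  have hl2 : 0 < Real.log 2 := Real.log_pos (by norm_num)
  refine ⟨(α * (α - 1) / Real.Gamma (2 - α)) * 2 ^ (-1 - α) * (ρ ^ 2 / 4 * Real.log 2 ^ 2),
    by positivity, fun u hu hul => ?_⟩
  rw [int_eq α hα1 hα2]
  have hint := K_integrable ρ α u hρ hα1 hα2 hu
  set c := α * (α - 1) / Real.Gamma (2 - α) with hc
  have hc0 : 0 < c := by positivity
  have hu0 : 0 < u := by linarith
  have hl : 0 < Real.log u := Real.log_pos (by linarith)
  have hsub : Set.Ioc u (2 * u) ⊆ Set.Ioi 0 := fun z hz => hu0.trans hz.1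
  have h1 : ∫ z in Set.Ioc u (2 * u), c * z ^ (-1 - α) * Kfun ρ u z ≤
      ∫ z in Set.Ioi 0, c * z ^ (-1 - α) * Kfun ρ u z := by
    refine setIntegral_mono_set hint ?_ hsub.eventuallyLE
    refine (ae_restrict_iff' measurableSet_Ioi).2 (.of_forall fun z hz => ?_)
    have hz0 : 0 < z := hz
    have hK := K_nonneg ρ u z hρ hu hz0
    simp only [Pi.zero_apply]
    positivity
  refine le_trans ?_ h1
  have h2 : ∫ z in Set.Ioc u (2 * u),
      c * (2 * u) ^ (-1 - α) * (ρ ^ 2 / 4 * (Real.log 2 / Real.log u) ^ 2) ≤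
      ∫ z in Set.Ioc u (2 * u), c * z ^ (-1 - α) * Kfun ρ u z := by
    refine setIntegral_mono_on (integrableOn_const (by simp)) (hint.mono_set hsub) measurableSet_Ioc fun z hz => ?_
    have hz0 : 0 < z := hu0.trans hz.1
    have hK := K_lower ρ u z hρ hu hz.1 hz.2 hul
    have : (2 * u) ^ (-1 - α) ≤ z ^ (-1 - α) :=
      Real.rpow_le_rpow_of_nonpos hz0 hz.2 (by linarith)
    gcongr
  refine le_trans (le_of_eq ?_) h2
  rw [setIntegral_const, Real.volume_real_Ioc_of_le (by linarith), smul_eq_mul,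
    Real.mul_rpow (by norm_num) hu0.le, Real.rpow_neg hl.le, Real.rpow_ofNat]
  have e : u ^ (-α) = u ^ (-1 - α) * u := by
    nth_rw 3 [← Real.rpow_one u]
    rw [← Real.rpow_add hu0]; congr 1; ring
  rw [e]
  field_simp
  ring

lemma log_pow_tendsto (s p : ℝ) (hp : 0 < p) :
    Filter.Tendsto (fun u : ℝ => Real.log u ^ (-s) * u ^ p) Filter.atTop Filter.atTop := by
  have h := (isLittleO_log_rpow_rpow_atTop s hp).tendsto_div_nhds_zero
  have h2 : Filter.Tendsto (fun u : ℝ => Real.log u ^ s / u ^ p) Filter.atTop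
      (nhdsWithin 0 (Set.Ioi 0)) := by
    refine tendsto_nhdsWithin_iff.2 ⟨h, ?_⟩
    filter_upwards [Filter.eventually_gt_atTop 3] with u hu
    have hl : 0 < Real.log u := Real.log_pos (by linarith)
    have hu0 : 0 < u := by linarith
    exact Set.mem_Ioi.2 (by positivity)
  refine h2.inv_tendsto_nhdsGT_zero.congr' ?_
  filter_upwards [Filter.eventually_gt_atTop 3] with u hu
  have hl : 0 < Real.log u := Real.log_pos (by linarith)
  rw [Pi.inv_apply, inv_div, Real.rpow_neg hl.le, div_eq_inv_mul]

theorem stmt_11 (ρ α b₁ b₂ r₁ r₂ : ℝ) (hρ : 0 < ρ) (hα1 : 1 < α) (hα2 : α < 2)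
    (hb₁ : 0 ≤ b₁) (hb₂ : 0 ≤ b₂)
    (hcrit : (0 < b₁ ∧ 2 < r₁) ∨ (0 < b₂ ∧ α < r₂)) :
    Filter.Tendsto
      (fun u : ℝ =>
        Real.log u ^ (-ρ - 2) *
          ((1 / 2) * b₁ * u ^ (r₁ - 2)
            + b₂ * u ^ r₂ * (∫ z in Set.Ioi (0 : ℝ), Kfun ρ u z ∂(muAlpha α))))
      Filter.atTop Filter.atTop := by
  rcases hcrit with ⟨hb, hr⟩ | ⟨hb, hr⟩
  · refine Filter.tendsto_atTop_mono' _ ?_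
      ((log_pow_tendsto (ρ + 2) (r₁ - 2) (by linarith)).const_mul_atTop (half_pos hb))
    filter_upwards [Filter.eventually_gt_atTop 3] with u hu
    have hl : 0 < Real.log u := Real.log_pos (by linarith)
    have hu0 : 0 < u := by linarith
    have hI := int_nonneg ρ α u hρ hα1 hα2 hu
    have e : -(ρ + 2) = -ρ - 2 := by ring
    rw [e]
    have : 0 ≤ Real.log u ^ (-ρ - 2) *
      (b₂ * u ^ r₂ * (∫ z in Set.Ioi (0 : ℝ), Kfun ρ u z ∂(muAlpha α))) := by positivity
    linarith
  · obtain ⟨D, hD, hI⟩ := int_lower ρ α hρ hα1 hα2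
    refine Filter.tendsto_atTop_mono' _ ?_
      ((log_pow_tendsto (ρ + 4) (r₂ - α) (by linarith)).const_mul_atTop (mul_pos hb hD))
    filter_upwards [Filter.eventually_gt_atTop 3,
      Real.tendsto_log_atTop.eventually_ge_atTop (ρ * Real.log 3 / 2)] with u hu hul
    have hl : 0 < Real.log u := Real.log_pos (by linarith)
    have hu0 : 0 < u := by linarith
    have e1 : Real.log u ^ (-(ρ + 4)) = Real.log u ^ (-ρ - 2) * Real.log u ^ (-2 : ℝ) := by
      rw [← Real.rpow_add hl]; congr 1; ring
    have e2 : u ^ (r₂ - α) = u ^ r₂ * u ^ (-α) := by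
      rw [← Real.rpow_add hu0]; congr 1
    have h0 : 0 ≤ (1 / 2) * b₁ * u ^ (r₁ - 2) := by positivity
    calc b₂ * D * (Real.log u ^ (-(ρ + 4)) * u ^ (r₂ - α))
        = Real.log u ^ (-ρ - 2) * (0 + b₂ * u ^ r₂ *
            (D * (u ^ (-α) * Real.log u ^ (-2 : ℝ)))) := by rw [e1, e2]; ring
      _ ≤ _ := by
        have := hI u hu hul
        gcongr
end

section
/- Let ρ > 0, let U ⊆ (0,∞) be a Borel set, let μ be a σ-finite Borel measure on U with ∫_U min(z,z^2) μ(dz) < ∞, let ν be a σ-finite Borel measure on (0,∞)∖U with ∫ max(1, ln(1+z)) ν(dz) < ∞, let a_0 : (0,∞) → ℝ and a_1, a_2, a_3 : (0,∞) → [0,∞) be functions, and let g(x) := 1 + (ln x)^{−ρ}. Then for every u > 3, Lg(u) ≥ ρ·(ln u)^{−ρ−1}·φ(u) + min(ρ,1)·(ln u)^{−ρ−2}·H_ρ(u). -/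
open MeasureTheory

/-- The generator
`Lg(u) = a₀(u)g′(u) + ½a₁(u)g″(u) + a₂(u)∫_U [g(u+z)−g(u)−zg′(u)] μ(dz)
  + a₃(u)∫_{(0,∞)∖U} [g(u+z)−g(u)] ν(dz)`. -/
noncomputable def Lop (U : Set ℝ) (μ ν : Measure ℝ) (a₀ a₁ a₂ a₃ : ℝ → ℝ)
    (g : ℝ → ℝ) (u : ℝ) : ℝ :=
  a₀ u * deriv g u + (1 / 2) * a₁ u * deriv (deriv g) u
    + a₂ u * (∫ z in U, (g (u + z) - g u - z * deriv g u) ∂μ)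
    + a₃ u * (∫ z in Set.Ioi (0 : ℝ) \ U, (g (u + z) - g u) ∂ν)

/-- The function
`φ(u) = −a₀(u)u⁻¹ + ½a₁(u)u⁻² + a₂(u)∫_U z²(∫₀¹ (u+vz)⁻²(1−v) dv) μ(dz)
  − a₃(u)∫_{(0,∞)∖U} z(∫₀¹ (u+vz)⁻¹ dv) ν(dz)`. -/
noncomputable def phiFun (U : Set ℝ) (μ ν : Measure ℝ) (a₀ a₁ a₂ a₃ : ℝ → ℝ) (u : ℝ) : ℝ :=
  -a₀ u * u ^ (-1 : ℝ) + (1 / 2) * a₁ u * u ^ (-2 : ℝ)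
    + a₂ u * (∫ z in U, z ^ 2 * (∫ v in (0 : ℝ)..1, (u + v * z) ^ (-2 : ℝ) * (1 - v)) ∂μ)
    - a₃ u * (∫ z in Set.Ioi (0 : ℝ) \ U, z * (∫ v in (0 : ℝ)..1, (u + v * z) ^ (-1 : ℝ)) ∂ν)

/-- `H_ρ(u) = ½a₁(u)u⁻² + a₂(u)∫_U K_ρ(u,z) μ(dz) + a₃(u)∫_{(0,∞)∖U} K_ρ(u,z) ν(dz)`. -/
noncomputable def Hfun (ρ : ℝ) (U : Set ℝ) (μ ν : Measure ℝ) (a₁ a₂ a₃ : ℝ → ℝ) (u : ℝ) : ℝ :=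
  (1 / 2) * a₁ u * u ^ (-2 : ℝ) + a₂ u * (∫ z in U, Kfun ρ u z ∂μ)
    + a₃ u * (∫ z in Set.Ioi (0 : ℝ) \ U, Kfun ρ u z ∂ν)

lemma aux_K_bounds (ρ R : ℝ) (hρ : 0 < ρ) (hR : 1 ≤ R) :
    0 ≤ R ^ (-ρ) + ρ * R - (ρ + 1) ∧ R ^ (-ρ) + ρ * R - (ρ + 1) ≤ ρ * (R - 1) ∧
    R ^ (-ρ) + ρ * R - (ρ + 1) ≤ (ρ + ρ ^ 2) * (R - 1) ^ 2 := by
  have hR0 : 0 < R := by linarith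
  have h1 : Real.log R ≤ R - 1 := Real.log_le_sub_one_of_pos hR0
  have h0 : 0 ≤ Real.log R := Real.log_nonneg hR
  have h2 : 1 - R⁻¹ ≤ Real.log R := Real.one_sub_inv_le_log_of_pos hR0
  have he : R ^ (-ρ) = Real.exp (-(ρ * Real.log R)) := by
    rw [Real.rpow_def_of_pos hR0]; ring_nf
  have hx : 0 ≤ ρ * Real.log R := by positivity
  refine ⟨?_, ?_, ?_⟩
  · have := Real.add_one_le_exp (-(ρ * Real.log R))
    rw [he]; nlinarith
  · have : R ^ (-ρ) ≤ 1 := Real.rpow_le_one_of_one_le_of_nonpos hR (by linarith)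
    linarith
  · have h3 : Real.exp (-(ρ * Real.log R)) ≤ 1 - ρ * Real.log R + (ρ * Real.log R) ^ 2 := by
      rw [Real.exp_neg]
      have h4 := Real.add_one_le_exp (ρ * Real.log R)
      have h5 : (Real.exp (ρ * Real.log R))⁻¹ ≤ (ρ * Real.log R + 1)⁻¹ := by
        gcongr
      refine h5.trans ?_
      rw [inv_le_iff_one_le_mul₀ (by positivity)]
      nlinarith [pow_nonneg hx 3]
    have h6 : R - 1 - Real.log R ≤ (R - 1) ^ 2 := by
      have : R⁻¹ ≤ 1 := inv_le_one_of_one_le₀ hR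
      have h7 : R * R⁻¹ = 1 := mul_inv_cancel₀ hR0.ne'
      nlinarith [mul_nonneg (sub_nonneg.2 hR) (sub_nonneg.2 this)]
    have h8 : (Real.log R) ^ 2 ≤ (R - 1) ^ 2 := by gcongr
    rw [he]
    nlinarith [mul_le_mul_of_nonneg_left h6 hρ.le, mul_le_mul_of_nonneg_left h8 (sq_nonneg ρ)]

lemma aux_inner2 (u z : ℝ) (hu : 0 < u) (hz : 0 < z) :
    z ^ 2 * (∫ v in (0 : ℝ)..1, (u + v * z) ^ (-2 : ℝ) * (1 - v))
      = z / u - (Real.log (u + z) - Real.log u) := by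
  rw [← intervalIntegral.integral_const_mul]
  have hpos : ∀ v ∈ Set.uIcc (0 : ℝ) 1, 0 < u + v * z := by
    intro v hv
    rw [Set.uIcc_of_le zero_le_one] at hv
    have := mul_nonneg hv.1 hz.le
    linarith
  rw [intervalIntegral.integral_eq_sub_of_hasDerivAt
    (f := fun v => -(z * (1 - v)) / (u + v * z) - Real.log (u + v * z))]
  · simp; ring
  · intro v hv
    have hp := hpos v hv
    have hl : HasDerivAt (fun v : ℝ => u + v * z) z v := by
      simpa using ((hasDerivAt_id v).mul_const z).const_add u
    have hn : HasDerivAt (fun v : ℝ => -(z * (1 - v))) z v := by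
      have := ((((hasDerivAt_id' v).const_sub 1)).const_mul z).fun_neg
      exact this.congr_deriv (by ring)
    refine ((hn.fun_div hl hp.ne').fun_sub (hl.log hp.ne')).congr_deriv ?_
    rw [show (-2 : ℝ) = ((-2 : ℤ) : ℝ) by norm_num, Real.rpow_intCast, zpow_neg]
    norm_cast
    field_simp
    ring
  · apply ContinuousOn.intervalIntegrable
    refine ContinuousOn.mul continuousOn_const (ContinuousOn.mul ?_ (by fun_prop))
    exact ContinuousOn.rpow_const (by fun_prop) (fun v hv => Or.inl (hpos v hv).ne')

lemma aux_inner1 (u z : ℝ) (hu : 0 < u) (hz : 0 < z) :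
    z * (∫ v in (0 : ℝ)..1, (u + v * z) ^ (-1 : ℝ))
      = Real.log (u + z) - Real.log u := by
  rw [← intervalIntegral.integral_const_mul]
  have hpos : ∀ v ∈ Set.uIcc (0 : ℝ) 1, 0 < u + v * z := by
    intro v hv
    rw [Set.uIcc_of_le zero_le_one] at hv
    have := mul_nonneg hv.1 hz.le
    linarith
  rw [intervalIntegral.integral_eq_sub_of_hasDerivAt
    (f := fun v => Real.log (u + v * z))]
  · simp
  · intro v hv
    have hp := hpos v hv
    have hl : HasDerivAt (fun v : ℝ => u + v * z) z v := by
      simpa using ((hasDerivAt_id v).mul_const z).const_add u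
    refine (hl.log hp.ne').congr_deriv ?_
    rw [Real.rpow_neg_one]
    field_simp
  · apply ContinuousOn.intervalIntegrable
    refine ContinuousOn.mul continuousOn_const ?_
    exact ContinuousOn.rpow_const (by fun_prop) (fun v hv => Or.inl (hpos v hv).ne')

lemma aux_deriv (ρ x : ℝ) (hx : 1 < x) (c : ℝ) :
    HasDerivAt (fun x => c + Real.log x ^ (-ρ)) (-ρ * Real.log x ^ (-ρ - 1) * x⁻¹) x := by
  have hl := Real.log_pos hx
  have := ((Real.hasDerivAt_log (by linarith : x ≠ 0)).rpow_const (p := -ρ)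
    (Or.inl hl.ne')).const_add c
  refine this.congr_deriv ?_
  ring

lemma aux_deriv2 (ρ u : ℝ) (hu : 1 < u) :
    deriv (deriv (fun x => 1 + Real.log x ^ (-ρ))) u
      = (ρ * Real.log u ^ (-ρ - 1) + ρ * (ρ + 1) * Real.log u ^ (-ρ - 2)) * u ^ (-2 : ℝ) := by
  have he : deriv (fun x => 1 + Real.log x ^ (-ρ)) =ᶠ[nhds u]
      fun x => -ρ * Real.log x ^ (-ρ - 1) * x⁻¹ := by
    filter_upwards [lt_mem_nhds hu] with x hx
    exact (aux_deriv ρ x hx 1).deriv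
  rw [he.deriv_eq]
  have hl := Real.log_pos hu
  have hu0 : u ≠ 0 := by linarith
  have h := ((((Real.hasDerivAt_log hu0).rpow_const (p := -ρ - 1)
    (Or.inl hl.ne')).const_mul (-ρ)).fun_mul (hasDerivAt_inv hu0))
  rw [h.deriv, show (-2 : ℝ) = ((-2 : ℤ) : ℝ) by norm_num, Real.rpow_intCast, zpow_neg,
    show -ρ - 1 - 1 = -ρ - 2 by ring]
  norm_cast
  field_simp
  ring_nf

theorem stmt_16 (ρ : ℝ) (hρ : 0 < ρ) (U : Set ℝ) (hU : MeasurableSet U)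
    (hUsub : U ⊆ Set.Ioi 0) (μ ν : Measure ℝ) [SigmaFinite μ] [SigmaFinite ν]
    (hμ : Integrable (fun z => min z (z ^ 2)) (μ.restrict U))
    (hν : Integrable (fun z => max 1 (Real.log (1 + z))) (ν.restrict (Set.Ioi 0 \ U)))
    (a₀ a₁ a₂ a₃ : ℝ → ℝ) (ha₁ : ∀ u, 0 < u → 0 ≤ a₁ u) (ha₂ : ∀ u, 0 < u → 0 ≤ a₂ u)
    (ha₃ : ∀ u, 0 < u → 0 ≤ a₃ u)
    (g : ℝ → ℝ) (hg : ∀ x, g x = 1 + Real.log x ^ (-ρ)) :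
    ∀ u : ℝ, 3 < u →
      Lop U μ ν a₀ a₁ a₂ a₃ g u ≥
        ρ * Real.log u ^ (-ρ - 1) * phiFun U μ ν a₀ a₁ a₂ a₃ u
          + min ρ 1 * Real.log u ^ (-ρ - 2) * Hfun ρ U μ ν a₁ a₂ a₃ u := by
  intro u hu
  have hge : g = fun x => 1 + Real.log x ^ (-ρ) := funext hg
  have hu0 : 0 < u := by linarith
  have hu1 : 1 < u := by linarith
  set l := Real.log u with hl
  have hl1 : 1 < l := by
    rw [hl, Real.lt_log_iff_exp_lt hu0]
    linarith [Real.exp_one_lt_d9]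
  have hl0 : 0 < l := by linarith
  have hd1 : deriv g u = -ρ * l ^ (-ρ - 1) * u⁻¹ := by
    rw [hge]; exact (aux_deriv ρ u hu1 1).deriv
  have hd2 : deriv (deriv g) u
      = (ρ * l ^ (-ρ - 1) + ρ * (ρ + 1) * l ^ (-ρ - 2)) * u ^ (-2 : ℝ) := by
    rw [hge]; exact aux_deriv2 ρ u hu1
  have hlp : l ^ (-ρ) = l ^ (-ρ - 1) * l := by
    rw [← Real.rpow_add_one hl0.ne']; ring_nf
  have hlogge : ∀ z, 0 < z → l ≤ Real.log (u + z) := fun z hz =>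
    Real.log_le_log hu0 (by linarith)
  have hR1 : ∀ z, 0 < z → 1 ≤ Real.log (u + z) / l := fun z hz => by
    rw [le_div_iff₀ hl0, one_mul]; exact hlogge z hz
  have hlogsub : ∀ z, 0 < z → Real.log (u + z) - l = Real.log (1 + z / u) := fun z hz => by
    rw [hl, ← Real.log_div (by linarith) hu0.ne']
    congr 1; field_simp
  have hzu : ∀ z, 0 < z → z / u ≤ z := fun z hz => div_le_self hz.le hu1.le
  have hlogle : ∀ z, 0 < z → Real.log (u + z) - l ≤ z := fun z hz => by
    rw [hlogsub z hz]
    have := Real.log_le_sub_one_of_pos (show 0 < 1 + z / u by positivity)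
    linarith [hzu z hz]
  have hlogle' : ∀ z, 0 < z → Real.log (u + z) - l ≤ Real.log (1 + z) := fun z hz => by
    rw [hlogsub z hz]
    exact Real.log_le_log (by positivity) (by linarith [hzu z hz])
  have hRsub : ∀ z, 0 < z → Real.log (u + z) / l - 1 ≤ Real.log (u + z) - l := fun z hz => by
    rw [show Real.log (u + z) / l - 1 = (Real.log (u + z) - l) / l by field_simp]
    exact div_le_self (by linarith [hlogge z hz]) hl1.le
  have hK0 : ∀ z, 0 < z → 0 ≤ Kfun ρ u z := fun z hz =>
    (aux_K_bounds ρ _ hρ (hR1 z hz)).1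
  have hKmeas : Measurable (Kfun ρ u) := by
    unfold Kfun; fun_prop
  have hUae : ∀ᵐ z ∂(μ.restrict U), 0 < z :=
    (ae_restrict_mem hU).mono fun z hz => hUsub hz
  have hVm : MeasurableSet (Set.Ioi (0 : ℝ) \ U) := measurableSet_Ioi.diff hU
  have hVae : ∀ᵐ z ∂(ν.restrict (Set.Ioi 0 \ U)), 0 < z :=
    (ae_restrict_mem hVm).mono fun z hz => hz.1
  have hKμ : Integrable (Kfun ρ u) (μ.restrict U) := by
    refine (hμ.const_mul (ρ + ρ ^ 2)).mono' hKmeas.aestronglyMeasurable ?_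
    filter_upwards [hUae] with z hz
    rw [Real.norm_of_nonneg (hK0 z hz)]
    obtain ⟨_, h1, h2⟩ := aux_K_bounds ρ _ hρ (hR1 z hz)
    have h3 := (hRsub z hz).trans (hlogle z hz)
    have h4 : 0 ≤ Real.log (u + z) / l - 1 := by linarith [hR1 z hz]
    have h5 : (Real.log (u + z) / l - 1) ^ 2 ≤ z ^ 2 := by gcongr
    rw [mul_min_of_nonneg _ _ (by positivity), le_min_iff]
    constructor
    · refine h1.trans ?_
      have := mul_le_mul_of_nonneg_left h3 hρ.le
      nlinarith [mul_nonneg (sq_nonneg ρ) hz.le]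
    · exact h2.trans (by gcongr)
  have hKν : Integrable (Kfun ρ u) (ν.restrict (Set.Ioi 0 \ U)) := by
    refine (hν.const_mul ρ).mono' hKmeas.aestronglyMeasurable ?_
    filter_upwards [hVae] with z hz
    rw [Real.norm_of_nonneg (hK0 z hz)]
    obtain ⟨_, h1, h2⟩ := aux_K_bounds ρ _ hρ (hR1 z hz)
    have h3 := (hRsub z hz).trans ((hlogle' z hz).trans (le_max_right 1 _))
    exact h1.trans (by gcongr)
  have hJμ : Integrable (fun z => z / u - (Real.log (u + z) - l)) (μ.restrict U) := by
    refine hμ.mono' (Measurable.aestronglyMeasurable (by fun_prop)) ?_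
    filter_upwards [hUae] with z hz
    have hp : 0 < 1 + z / u := by positivity
    have ht : 0 < z / u := by positivity
    have h1 := Real.log_le_sub_one_of_pos hp
    have h2 := Real.one_sub_inv_le_log_of_pos hp
    have h3 := Real.log_nonneg (show 1 ≤ 1 + z / u by linarith)
    rw [hlogsub z hz, Real.norm_of_nonneg (by linarith), le_min_iff]
    constructor
    · linarith [hzu z hz]
    · have h4 : z / u - (1 - (1 + z / u)⁻¹) ≤ (z / u) ^ 2 := by
        have h7 : (1 + z / u) * (1 + z / u)⁻¹ = 1 := mul_inv_cancel₀ hp.ne'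
        have h8 : (1 + z / u)⁻¹ ≤ 1 := inv_le_one_of_one_le₀ (by linarith)
        nlinarith [mul_nonneg ht.le (sub_nonneg.2 h8)]
      have h5 : (z / u) ^ 2 ≤ z ^ 2 := by
        have := hzu z hz
        gcongr
      linarith
  have hJν : Integrable (fun z => Real.log (u + z) - l) (ν.restrict (Set.Ioi 0 \ U)) := by
    refine hν.mono' (Measurable.aestronglyMeasurable (by fun_prop)) ?_
    filter_upwards [hVae] with z hz
    rw [Real.norm_of_nonneg (by linarith [hlogge z hz])]
    exact (hlogle' z hz).trans (le_max_right 1 _)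
  have hpow : ∀ z, 0 < z → Real.log (u + z) ^ (-ρ)
      = l ^ (-ρ) * (Real.log (u + z) / l) ^ (-ρ) := fun z hz => by
    rw [← Real.mul_rpow hl0.le (by linarith [hR1 z hz])]
    congr 1; field_simp
  have e1 : ∫ z in U, (g (u + z) - g u - z * deriv g u) ∂μ
      = l ^ (-ρ) * (∫ z in U, Kfun ρ u z ∂μ)
        + ρ * l ^ (-ρ - 1) * ∫ z in U, (z / u - (Real.log (u + z) - l)) ∂μ := by
    rw [← integral_const_mul, ← integral_const_mul,
      ← integral_add (hKμ.const_mul _) (hJμ.const_mul _)]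
    refine integral_congr_ae ?_
    filter_upwards [hUae] with z hz
    rw [hd1, hg, hg, hpow z hz, Kfun, ← hl, hlp]
    field_simp
    ring
  have e2 : ∫ z in U, z ^ 2 * (∫ v in (0 : ℝ)..1, (u + v * z) ^ (-2 : ℝ) * (1 - v)) ∂μ
      = ∫ z in U, (z / u - (Real.log (u + z) - l)) ∂μ := by
    refine integral_congr_ae ?_
    filter_upwards [hUae] with z hz
    exact aux_inner2 u z hu0 hz
  have e3 : ∫ z in Set.Ioi (0 : ℝ) \ U, (g (u + z) - g u) ∂ν
      = l ^ (-ρ) * (∫ z in Set.Ioi (0 : ℝ) \ U, Kfun ρ u z ∂ν)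
        - ρ * l ^ (-ρ - 1) * ∫ z in Set.Ioi (0 : ℝ) \ U, (Real.log (u + z) - l) ∂ν := by
    rw [← integral_const_mul, ← integral_const_mul,
      ← integral_sub (hKν.const_mul _) (hJν.const_mul _)]
    refine integral_congr_ae ?_
    filter_upwards [hVae] with z hz
    rw [hg, hg, hpow z hz, Kfun, ← hl, hlp]
    field_simp
    ring
  have e4 : ∫ z in Set.Ioi (0 : ℝ) \ U, z * (∫ v in (0 : ℝ)..1, (u + v * z) ^ (-1 : ℝ)) ∂ν
      = ∫ z in Set.Ioi (0 : ℝ) \ U, (Real.log (u + z) - l) ∂ν := by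
    refine integral_congr_ae ?_
    filter_upwards [hVae] with z hz
    exact aux_inner1 u z hu0 hz
  have k1 : 0 ≤ ∫ z in U, Kfun ρ u z ∂μ := integral_nonneg_of_ae (hUae.mono hK0)
  have k2 : 0 ≤ ∫ z in Set.Ioi (0 : ℝ) \ U, Kfun ρ u z ∂ν :=
    integral_nonneg_of_ae (hVae.mono hK0)
  unfold Lop phiFun Hfun
  rw [e1, e2, e3, e4, hd1, hd2, Real.rpow_neg_one]
  generalize (∫ z in U, Kfun ρ u z ∂μ) = A at *
  generalize (∫ z in Set.Ioi (0 : ℝ) \ U, Kfun ρ u z ∂ν) = B at *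
  generalize (∫ z in U, (z / u - (Real.log (u + z) - l)) ∂μ) = C
  generalize (∫ z in Set.Ioi (0 : ℝ) \ U, (Real.log (u + z) - l) ∂ν) = D
  have hq : 0 ≤ l ^ (-ρ - 2) := by positivity
  have hq2 : l ^ (-ρ - 2) ≤ l ^ (-ρ) := Real.rpow_le_rpow_of_exponent_le hl1.le (by linarith)
  have hm0 : 0 ≤ min ρ 1 := le_min hρ.le zero_le_one
  have hc : min ρ 1 * l ^ (-ρ - 2) ≤ l ^ (-ρ) :=
    (mul_le_of_le_one_left hq (min_le_right _ _)).trans hq2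
  have hc1 : min ρ 1 * l ^ (-ρ - 2) ≤ ρ * (ρ + 1) * l ^ (-ρ - 2) := by
    refine mul_le_mul_of_nonneg_right ((min_le_left _ _).trans ?_) hq
    nlinarith
  have p1 : 0 ≤ (1 / 2) * a₁ u * u ^ (-2 : ℝ) := by
    have := ha₁ u hu0
    positivity
  have t1 := mul_le_mul_of_nonneg_right hc1 p1
  have t2 := mul_le_mul_of_nonneg_right hc (mul_nonneg (ha₂ u hu0) k1)
  have t3 := mul_le_mul_of_nonneg_right hc (mul_nonneg (ha₃ u hu0) k2)
  rw [ge_iff_le, ← sub_nonneg]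
  have := add_nonneg (add_nonneg (sub_nonneg.2 t1) (sub_nonneg.2 t2)) (sub_nonneg.2 t3)
  refine this.trans_eq ?_
  ring
end
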